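/- arXiv:2404.14365 — 3 statements merged into one kernel-verified Lean document; each statement's English description precedes it below -/
import Mathlib

section
/- Let k ≥ 1 and let Q_0, …, Q_k ∈ ℂ[x] with Q_k ≠ 0, let T(p) = ∑_{j=0}^k Q_j · p^{(j)}, and assume T is degenerate, i.e. deg Q_j − j > deg Q_k − k for some 0 ≤ j < k with Q_j ≠ 0. Then for every integer n ≥ 1 and every nonempty closed set S ⊆ ℂ, S is T_{≥n}-invariant if and only if S is T_{≥0}-invariant. -/
open Polynomial

/-- The differential operator `T(p) = ∑_{j=0}^k Q_j · p^{(j)}`. -/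
noncomputable def diffOp (k : ℕ) (Q : ℕ → Polynomial ℂ) (p : Polynomial ℂ) : Polynomial ℂ :=
  ∑ j ∈ Finset.range (k + 1), Q j * (⇑(Polynomial.derivative (R := ℂ)))^[j] p

/-- A set `S ⊆ ℂ` is `T_{≥n}`-invariant: for every nonzero polynomial `p` with `deg p ≥ n`
all of whose zeros lie in `S`, either `T p = 0` or all zeros of `T p` lie in `S`. -/
def TGeInvariant (T : Polynomial ℂ → Polynomial ℂ) (n : ℕ) (S : Set ℂ) : Prop :=
  ∀ p : Polynomial ℂ, p ≠ 0 → n ≤ p.natDegree → (∀ z : ℂ, p.eval z = 0 → z ∈ S) →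
    T p = 0 ∨ ∀ z : ℂ, (T p).eval z = 0 → z ∈ S

/-- `T` is degenerate: `deg Q_j − j > deg Q_k − k` for some `0 ≤ j < k` with `Q_j ≠ 0`. -/
def Degenerate (k : ℕ) (Q : ℕ → Polynomial ℂ) : Prop :=
  ∃ j < k, Q j ≠ 0 ∧ ((Q k).natDegree : ℤ) - k < ((Q j).natDegree : ℤ) - j

open Filter Topology

theorem diffOp_mul_X_sub_C (k : ℕ) (Q : ℕ → ℂ[X]) (p : ℂ[X]) (w : ℂ) :
    diffOp k Q (p * (X - C w)) = diffOp k Q (p * X) - C w * diffOp k Q p := by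
  have h : p * (X - C w) = p * X - C w * p := by ring
  simp only [diffOp, h, iterate_derivative_sub, iterate_derivative_C_mul, mul_sub,
    Finset.sum_sub_distrib, Finset.mul_sum]
  congr 1
  exact Finset.sum_congr rfl fun j _ => by ring

/-- If all zeros of `P` have distance at least `r` from `z`, then the values of `P` are controlled
by its value at `z`. -/
theorem norm_eval_le_of_le_dist_roots {P : ℂ[X]} {z : ℂ} {r : ℝ} {D : ℕ} (hr : 0 < r)
    (hD : P.natDegree ≤ D) (hP : ∀ a ∈ P.roots, r ≤ ‖z - a‖) (y : ℂ) :
    ‖P.eval y‖ ≤ ‖P.eval z‖ * (1 + ‖y - z‖ / r) ^ D := by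
  have hone : 1 ≤ 1 + ‖y - z‖ / r := le_add_of_nonneg_right (by positivity)
  have key : ∀ s : Multiset ℂ, (∀ a ∈ s, r ≤ ‖z - a‖) →
      ‖(s.map (y - ·)).prod‖ ≤ ‖(s.map (z - ·)).prod‖ * (1 + ‖y - z‖ / r) ^ s.card := by
    intro s
    induction s using Multiset.induction_on with
    | empty => simp
    | cons a s ih =>
      intro hs
      have ha : r ≤ ‖z - a‖ := hs a (Multiset.mem_cons_self a s)
      have hfac : ‖y - a‖ ≤ ‖z - a‖ * (1 + ‖y - z‖ / r) := by
        have h₁ : ‖y - a‖ ≤ ‖y - z‖ + ‖z - a‖ := norm_sub_le_norm_sub_add_norm_sub y z a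
        have h₂ : ‖y - z‖ = r * (‖y - z‖ / r) := by field_simp
        have h₃ : r * (‖y - z‖ / r) ≤ ‖z - a‖ * (‖y - z‖ / r) := by gcongr
        linarith
      have ih' := ih fun b hb => hs b (Multiset.mem_cons_of_mem hb)
      simp only [Multiset.map_cons, Multiset.prod_cons, norm_mul, Multiset.card_cons, pow_succ]
      calc ‖y - a‖ * ‖(s.map (y - ·)).prod‖
          ≤ (‖z - a‖ * (1 + ‖y - z‖ / r)) *
            (‖(s.map (z - ·)).prod‖ * (1 + ‖y - z‖ / r) ^ s.card) := by gcongr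
        _ = _ := by ring
  have hsplit := IsAlgClosed.splits P
  rw [hsplit.eval_eq_prod_roots y, hsplit.eval_eq_prod_roots z, norm_mul, norm_mul, mul_assoc]
  gcongr
  exact (key _ hP).trans <| by
    gcongr
    exact (card_roots' P).trans hD

/-- On an unbounded closed set, invariance passes to polynomials of degree one less: multiply by
`X - w` and let `w` tend to infinity inside the set. -/
theorem TGeInvariant.of_succ {k n : ℕ} {Q : ℕ → ℂ[X]} {S : Set ℂ} (hS : IsClosed S)
    (hunb : ∀ M : ℝ, ∃ w ∈ S, M < ‖w‖) (h : TGeInvariant (diffOp k Q) (n + 1) S) :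
    TGeInvariant (diffOp k Q) n S := by
  intro p hp hn hroots
  by_contra! hcon
  obtain ⟨hA, z, hz, hzS⟩ := hcon
  obtain ⟨r, hr, hball⟩ := Metric.isOpen_iff.1 hS.isOpen_compl z hzS
  obtain ⟨y, hy⟩ : ∃ y, (diffOp k Q p).eval y ≠ 0 := by
    by_contra! hy
    exact hA (Polynomial.funext fun y => by simpa using hy y)
  set A := diffOp k Q p
  set B := diffOp k Q (p * X)
  set K := ‖B.eval z‖ * (1 + ‖y - z‖ / r) ^ max B.natDegree A.natDegree
  have hbound : ∀ w ∈ S, ‖B.eval y - w * A.eval y‖ ≤ K := by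
    intro w hw
    have hroot : ∀ a ∈ (B - C w * A).roots, r ≤ ‖z - a‖ := by
      intro a ha
      have hmem : a ∈ S := by
        rcases h (p * (X - C w)) (mul_ne_zero hp (X_sub_C_ne_zero w))
          (by rw [natDegree_mul hp (X_sub_C_ne_zero w), natDegree_X_sub_C]; omega)
          (fun b hb => by
            rw [eval_mul, mul_eq_zero] at hb
            rcases hb with hb | hb
            · exact hroots b hb
            · have : b = w := by simpa [sub_eq_zero] using hb
              rwa [this]) with h0 | h0
        · rw [diffOp_mul_X_sub_C] at h0
          exact absurd h0 (ne_zero_of_mem_roots ha)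
        · rw [diffOp_mul_X_sub_C] at h0
          exact h0 a (isRoot_of_mem_roots ha)
      by_contra! hlt
      exact hball (by rwa [Metric.mem_ball, dist_comm, dist_eq_norm]) hmem
    have hdeg : (B - C w * A).natDegree ≤ max B.natDegree A.natDegree :=
      (natDegree_sub_le _ _).trans (max_le_max le_rfl (natDegree_C_mul_le _ _))
    simpa [hz] using norm_eval_le_of_le_dist_roots hr hdeg hroot y
  obtain ⟨w, hwS, hw⟩ := hunb ((K + ‖B.eval y‖) / ‖A.eval y‖)
  rw [div_lt_iff₀ (norm_pos_iff.2 hy), ← norm_mul] at hw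
  have h₁ := hbound w hwS
  have h₂ := norm_sub_norm_le (w * A.eval y) (B.eval y)
  rw [norm_sub_rev] at h₂
  linarith

theorem tendsto_descFactorial_div_descFactorial_zero {j k : ℕ} (hjk : j < k) :
    Tendsto (fun m : ℕ => (m.descFactorial j : ℂ) / m.descFactorial k) atTop (𝓝 0) := by
  have h₁ : Tendsto (fun m : ℕ => (m : ℝ) ^ j / (m : ℝ) ^ k) atTop (𝓝 0) :=
    (tendsto_pow_div_pow_atTop_zero hjk).comp tendsto_natCast_atTop_atTop
  have h₂ := ((isEquivalent_descFactorial j).div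
    (isEquivalent_descFactorial k)).symm.tendsto_nhds h₁
  have h₃ := (Complex.continuous_ofReal.tendsto 0).comp h₂
  simpa [Function.comp_def] using h₃

theorem tendsto_sum_descFactorial_mul_div (c : ℕ → ℂ) (k : ℕ) :
    Tendsto (fun m : ℕ => (∑ j ∈ Finset.range (k + 1), (m.descFactorial j : ℂ) * c j) /
      m.descFactorial k) atTop (𝓝 (c k)) := by
  have h₁ : Tendsto (fun m : ℕ => ∑ j ∈ Finset.range k,
      (m.descFactorial j : ℂ) / m.descFactorial k * c j) atTop (𝓝 0) := by
    rw [← Finset.sum_const_zero (s := Finset.range k)]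
    refine tendsto_finsetSum _ fun j hj => ?_
    simpa using
      (tendsto_descFactorial_div_descFactorial_zero (Finset.mem_range.1 hj)).mul_const (c j)
  have h₂ := h₁.add_const (c k)
  rw [zero_add] at h₂
  refine h₂.congr' ?_
  filter_upwards [eventually_ge_atTop k] with m hm
  have hne : (m.descFactorial k : ℂ) ≠ 0 := by
    exact_mod_cast (Nat.descFactorial_pos.2 hm).ne'
  rw [Finset.sum_range_succ, add_div, Finset.sum_div, mul_div_cancel_left₀ _ hne]
  congr 1
  exact Finset.sum_congr rfl fun j _ => by ring

theorem eventually_sum_descFactorial_mul_ne_zero {c : ℕ → ℂ} {k : ℕ}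
    (hc : ∃ j ∈ Finset.range (k + 1), c j ≠ 0) :
    ∀ᶠ m : ℕ in atTop, ∑ j ∈ Finset.range (k + 1), (m.descFactorial j : ℂ) * c j ≠ 0 := by
  classical
  obtain ⟨i, hi, hci⟩ := hc
  obtain ⟨J, hJ, hmax⟩ := Finset.exists_max_image ((Finset.range (k + 1)).filter (c · ≠ 0)) id
    ⟨i, Finset.mem_filter.2 ⟨hi, hci⟩⟩
  rw [Finset.mem_filter, Finset.mem_range] at hJ
  filter_upwards [(tendsto_sum_descFactorial_mul_div c J).eventually_ne hJ.2] with m hm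
  rw [← Finset.sum_subset (Finset.range_subset_range.2 (show J + 1 ≤ k + 1 by omega))]
  · exact fun h0 => hm (by rw [h0, zero_div])
  · intro j hj hjJ
    by_contra hne
    have := hmax j (Finset.mem_filter.2 ⟨hj, right_ne_zero_of_mul hne⟩)
    simp only [id, Finset.mem_range] at this hjJ
    omega

theorem norm_coeff_le_of_norm_roots_le {P : ℂ[X]} (hP : P ≠ 0) {M : ℝ}
    (hM : ∀ a ∈ P.roots, ‖a‖ ≤ M) (i : ℕ) :
    ‖P.coeff i‖ ≤ ‖P.leadingCoeff‖ * (M ^ (P.natDegree - i) * P.natDegree.choose i) := by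
  have hl : P.leadingCoeff ≠ 0 := leadingCoeff_ne_zero.2 hP
  have hmonic : (C P.leadingCoeff⁻¹ * P).Monic := by
    simp [Monic, leadingCoeff_mul, hl]
  have h := coeff_le_of_roots_le (f := RingHom.id ℂ) i hmonic (IsAlgClosed.splits _)
    (B := M) (by rw [Polynomial.map_id, roots_C_mul _ (inv_ne_zero hl)]; exact hM)
  rw [Polynomial.map_id, coeff_C_mul, norm_mul, norm_inv, natDegree_C_mul (inv_ne_zero hl)] at h
  rwa [inv_mul_le_iff₀ (norm_pos_iff.2 hl)] at h

theorem diffOp_X_sub_C_pow (k : ℕ) (Q : ℕ → ℂ[X]) (u : ℂ) {m : ℕ} (hm : k ≤ m) :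
    diffOp k Q ((X - C u) ^ m) = (X - C u) ^ (m - k) *
      ∑ j ∈ Finset.range (k + 1), C (m.descFactorial j : ℂ) * (Q j * (X - C u) ^ (k - j)) := by
  rw [diffOp, Finset.mul_sum]
  refine Finset.sum_congr rfl fun j hj => ?_
  have hj' : j ≤ k := Nat.lt_succ_iff.1 (Finset.mem_range.1 hj)
  rw [iterate_derivative_X_sub_pow, show m - j = (m - k) + (k - j) by omega, pow_add,
    nsmul_eq_mul, C_eq_natCast]
  ring

/-- Nonempty invariant sets of degenerate operators are unbounded. -/
theorem TGeInvariant.exists_lt_norm {k n : ℕ} {Q : ℕ → ℂ[X]} (hQk : Q k ≠ 0)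
    (hdeg : Degenerate k Q) {S : Set ℂ} (hne : S.Nonempty)
    (h : TGeInvariant (diffOp k Q) n S) (M : ℝ) : ∃ w ∈ S, M < ‖w‖ := by
  by_contra! hM
  obtain ⟨u, hu⟩ := hne
  obtain ⟨i, hik, hQi, hlt⟩ := hdeg
  set W : ℕ → ℂ[X] := fun j => Q j * (X - C u) ^ (k - j) with hW
  have hWk : W k = Q k := by simp [hW]
  obtain ⟨J, hJ, hmax⟩ := Finset.exists_max_image (Finset.range (k + 1))
    (fun j => (W j).natDegree) ⟨k, Finset.self_mem_range_succ k⟩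
  set N := (W J).natDegree
  have hNk : (Q k).natDegree < N := by
    have h₁ := hmax i (Finset.mem_range.2 (by omega))
    have h₂ : (W i).natDegree = (Q i).natDegree + (k - i) := by
      rw [natDegree_mul hQi (pow_ne_zero _ (X_sub_C_ne_zero u)), natDegree_pow,
        natDegree_X_sub_C, mul_one]
    omega
  have hWJ : (W J).coeff N ≠ 0 := by
    refine leadingCoeff_ne_zero.2 fun h0 => ?_
    simp only [N, h0, natDegree_zero] at hNk
    omega
  set R : ℕ → ℂ[X] := fun m =>
    ∑ j ∈ Finset.range (k + 1), C (m.descFactorial j : ℂ) * W j with hR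
  have hcoeff : ∀ m l, (R m).coeff l =
      ∑ j ∈ Finset.range (k + 1), (m.descFactorial j : ℂ) * (W j).coeff l := by
    intro m l
    simp only [hR, finsetSum_coeff, coeff_C_mul]
  set K : ℝ := M ^ (N - (Q k).natDegree) * N.choose (Q k).natDegree
  have hbound : ∀ᶠ m : ℕ in atTop,
      ‖(R m).coeff (Q k).natDegree / m.descFactorial k‖ ≤
        ‖(R m).coeff N / m.descFactorial k‖ * K := by
    filter_upwards [eventually_ge_atTop k, eventually_ge_atTop n,
      eventually_sum_descFactorial_mul_ne_zero (c := fun j => (W j).coeff N) ⟨J, hJ, hWJ⟩]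
      with m hkm hnm hm
    rw [← hcoeff] at hm
    have hRm : R m ≠ 0 := fun h0 => hm (by rw [h0, coeff_zero])
    have hdegR : (R m).natDegree = N := by
      refine le_antisymm ?_ (le_natDegree_of_ne_zero hm)
      exact natDegree_sum_le_of_forall_le _ _ fun j hj =>
        (natDegree_C_mul_le _ _).trans (hmax j hj)
    have hT := diffOp_X_sub_C_pow k Q u hkm
    have hroots : ∀ a ∈ (R m).roots, ‖a‖ ≤ M := by
      intro a ha
      refine hM a ?_
      rcases h ((X - C u) ^ m) (pow_ne_zero _ (X_sub_C_ne_zero u))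
        (by rwa [natDegree_pow, natDegree_X_sub_C, mul_one])
        (fun b hb => by
          rw [eval_pow] at hb
          have : b = u := by simpa [sub_eq_zero] using eq_zero_of_pow_eq_zero hb
          rwa [this]) with h0 | h0
      · rw [hT] at h0
        exact absurd h0 (mul_ne_zero (pow_ne_zero _ (X_sub_C_ne_zero u)) hRm)
      · refine h0 a ?_
        rw [hT, eval_mul]
        exact mul_eq_zero_of_right _ (isRoot_of_mem_roots ha)
    have hle := norm_coeff_le_of_norm_roots_le hRm hroots (Q k).natDegree
    rw [leadingCoeff, hdegR] at hle
    rw [norm_div, norm_div, div_mul_eq_mul_div]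
    gcongr
  have hlim : ∀ l, Tendsto (fun m : ℕ => ‖(R m).coeff l / m.descFactorial k‖) atTop
      (𝓝 ‖(Q k).coeff l‖) := by
    intro l
    simp only [hcoeff, ← hWk]
    exact (tendsto_sum_descFactorial_mul_div (fun j => (W j).coeff l) k).norm
  have hle := le_of_tendsto_of_tendsto (hlim _) ((hlim N).mul_const K) hbound
  rw [coeff_eq_zero_of_natDegree_lt hNk, norm_zero, zero_mul] at hle
  exact leadingCoeff_ne_zero.2 hQk (norm_le_zero_iff.1 hle)

theorem degenerate_TGe_invariance_independent_of_n (k : ℕ) (hk : 1 ≤ k)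
    (Q : ℕ → Polynomial ℂ) (hQk : Q k ≠ 0) (hdeg : Degenerate k Q)
    (n : ℕ) (hn : 1 ≤ n) (S : Set ℂ) (hSne : S.Nonempty) (hSclosed : IsClosed S) :
    TGeInvariant (diffOp k Q) n S ↔ TGeInvariant (diffOp k Q) 0 S := by
  refine ⟨fun h => ?_, fun h p hp _ => h p hp (Nat.zero_le _)⟩
  have hunb := h.exists_lt_norm hQk hdeg hSne
  clear hn
  induction n with
  | zero => exact h
  | succ n ih => exact ih (h.of_succ hSclosed hunb)
end

section
/- Let k ≥ 1 and a_0, …, a_k ∈ ℂ with a_k ≠ 0, and let T(p) = ∑_{j=0}^k a_j · p^{(j)} be the associated constant-coefficient differential operator. Let λ_1, …, λ_k ∈ ℂ be the roots (with multiplicity) of the characteristic polynomial a_k t^k + a_{k−1} t^{k−1} + ⋯ + a_0, and let C ⊆ ℂ be the convex cone consisting of all finite sums ∑ α_i λ_i^{−1} with real coefficients α_i ≥ 0, where the sum ranges over those indices i with λ_i ≠ 0 (so C = {0} if all λ_i = 0). Then a closed convex set S ⊆ ℂ is T_{≥0}-invariant if and only if z + v ∈ S for every z ∈ S and every v ∈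 C. -/
open Polynomial

/-- A set `S ⊆ ℂ` is `T_{≥0}`-invariant (i.e. `T`-invariant): for every nonzero polynomial
`p` all of whose zeros lie in `S`, either `T p = 0` or all zeros of `T p` lie in `S`. -/
def TInvariant (T : Polynomial ℂ → Polynomial ℂ) (S : Set ℂ) : Prop :=
  ∀ p : Polynomial ℂ, p ≠ 0 → (∀ z : ℂ, p.eval z = 0 → z ∈ S) →
    T p = 0 ∨ ∀ z : ℂ, (T p).eval z = 0 → z ∈ S

open Filter Topology ComplexConjugate

lemma Complex.re_inv_mul_conj_pos {w c : ℂ} (h : 0 < (w * c).re) : 0 < (w⁻¹ * conj c).re := by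
  have hw : w ≠ 0 := by
    rintro rfl
    simp at h
  have e : w⁻¹ * conj c = (((Complex.normSq w)⁻¹ : ℝ) : ℂ) * conj (w * c) := by
    rw [Complex.inv_def, map_mul]
    ring
  rw [e, Complex.re_ofReal_mul, Complex.conj_re]
  exact mul_pos (inv_pos.2 (Complex.normSq_pos.2 hw)) h

/-- If `S` is closed convex and stable under translation by nonnegative multiples of `l⁻¹`, then
`p ↦ p' - l p` preserves the property of being zero or having all zeros in `S`. -/
lemma mem_of_eval_derivative_sub_eq_zero {S : Set ℂ} (hSclosed : IsClosed S) (hSconv : Convex ℝ S)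
    {l : ℂ} (hl : ∀ z ∈ S, ∀ t : ℝ, 0 ≤ t → z + (t : ℂ) * l⁻¹ ∈ S) {p : ℂ[X]}
    (hp : p = 0 ∨ ∀ z, p.eval z = 0 → z ∈ S) :
    derivative p - C l * p = 0 ∨ ∀ z, (derivative p - C l * p).eval z = 0 → z ∈ S := by
  rcases hp with rfl | hp
  · simp
  refine or_iff_not_imp_left.2 fun h0 z hz => ?_
  by_contra hzS
  have hpz : p.eval z ≠ 0 := fun h => hzS (hp z h)
  have hp0 : p ≠ 0 := by
    rintro rfl
    simp at hpz
  have hsum : (p.roots.map fun r ↦ 1 / (z - r)).sum = l := by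
    rw [← (IsAlgClosed.splits p).eval_derivative_div_eval_of_ne_zero hpz, div_eq_iff hpz]
    simpa [sub_eq_zero] using hz
  have hne : p.roots ≠ 0 := by
    intro h
    have hl0 : l = 0 := by simpa [h] using hsum.symm
    have hdeg : p.natDegree = 0 := by simp [(IsAlgClosed.splits p).natDegree_eq_card_roots, h]
    apply h0
    rw [hl0, natDegree_eq_zero_iff_degree_le_zero.1 hdeg |> eq_C_of_degree_le_zero]
    simp
  obtain ⟨f, u, hfS, hfz⟩ :=
    RCLike.geometric_hahn_banach_closed_point (𝕜 := ℂ) hSconv hSclosed hzS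
  have hf : ∀ w, f w = w * f 1 := fun w => by
    simpa using f.map_smul w 1
  have hroot : ∀ r ∈ p.roots, r ∈ S := fun r hr => hp r (isRoot_of_mem_roots hr)
  have hpos : 0 < (l * conj (f 1)).re := by
    rw [← hsum]
    refine Multiset.sum_induction_nonempty (fun w : ℂ => 0 < (w * conj (f 1)).re)
      (fun a b ha hb => ?_) (by simpa using hne) ?_
    · rw [add_mul, Complex.add_re]
      exact add_pos ha hb
    · intro w hw
      obtain ⟨r, hr, rfl⟩ := Multiset.mem_map.1 hw
      rw [one_div]
      apply Complex.re_inv_mul_conj_pos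
      rw [← hf, map_sub, Complex.sub_re]
      exact sub_pos.2 ((hfS r (hroot r hr)).trans hfz)
  have hpos' := Complex.re_inv_mul_conj_pos hpos
  rw [Complex.conj_conj, ← hf] at hpos'
  obtain ⟨r, hr⟩ := Multiset.exists_mem_of_ne_zero hne
  have hrS := hroot r hr
  have hru := hfS r hrS
  have key := hfS _ (hl r hrS ((u - (f r).re) / (f l⁻¹).re)
    (div_nonneg (sub_nonneg.2 hru.le) hpos'.le))
  rw [map_add, ← smul_eq_mul, f.map_smul, smul_eq_mul] at key
  change ((f r) + _).re < u at key
  rw [Complex.add_re, Complex.re_ofReal_mul, div_mul_cancel₀ _ hpos'.ne'] at key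
  linarith

lemma pow_card_le_norm_prod_sub {s : Multiset ℂ} {x : ℂ} {c : ℝ} (hc : 0 ≤ c)
    (h : ∀ r ∈ s, c ≤ ‖x - r‖) : c ^ s.card ≤ ‖(s.map (x - ·)).prod‖ := by
  induction s using Multiset.induction_on with
  | empty => simp
  | cons r s ih =>
    rw [Multiset.card_cons, Multiset.map_cons, Multiset.prod_cons, norm_mul, pow_succ']
    exact mul_le_mul (h r (Multiset.mem_cons_self r s))
      (ih fun r' hr' => h r' (Multiset.mem_cons_of_mem hr')) (by positivity) (norm_nonneg _)

/-- A polynomial that is small at `x` has a zero near `x`. -/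
lemma exists_root_norm_sub_lt {f : ℂ[X]} {x : ℂ} {ε : ℝ} (hε : 0 ≤ ε)
    (h : ‖f.eval x‖ < ‖f.leadingCoeff‖ * ε ^ f.natDegree) : ∃ r, f.eval r = 0 ∧ ‖x - r‖ < ε := by
  by_contra! hcon
  refine h.not_ge ?_
  rw [(IsAlgClosed.splits f).eval_eq_prod_roots, norm_mul,
    (IsAlgClosed.splits f).natDegree_eq_card_roots]
  exact mul_le_mul_of_nonneg_left
    (pow_card_le_norm_prod_sub hε fun r hr => hcon r (isRoot_of_mem_roots hr)) (norm_nonneg _)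

/-- The symbol `∑ a j tʲ`, with coefficients rescaled by `n (n - 1) ⋯ (n - j + 1) / nʲ`. -/
noncomputable def scaledSymbol (k : ℕ) (a : ℕ → ℂ) (n : ℕ) : ℂ[X] :=
  ∑ j ∈ Finset.range (k + 1), C (a j * ((n.descFactorial j : ℂ) / (n : ℂ) ^ j)) * X ^ j

lemma coeff_scaledSymbol_self (k : ℕ) (a : ℕ → ℂ) (n : ℕ) :
    (scaledSymbol k a n).coeff k = a k * ((n.descFactorial k : ℂ) / (n : ℂ) ^ k) := by
  simp only [scaledSymbol, finsetSum_coeff, coeff_C_mul, coeff_X_pow]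
  simp

lemma coeff_scaledSymbol_self_ne_zero {k : ℕ} {a : ℕ → ℂ} (hak : a k ≠ 0) {n : ℕ} (hkn : k ≤ n)
    (hn : n ≠ 0) : (scaledSymbol k a n).coeff k ≠ 0 := by
  rw [coeff_scaledSymbol_self]
  have : n.descFactorial k ≠ 0 := by
    rw [Ne, Nat.descFactorial_eq_zero_iff_lt]
    omega
  exact mul_ne_zero hak (div_ne_zero (by exact_mod_cast this)
    (pow_ne_zero _ (by exact_mod_cast hn)))

lemma natDegree_scaledSymbol {k : ℕ} {a : ℕ → ℂ} (hak : a k ≠ 0) {n : ℕ} (hkn : k ≤ n)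
    (hn : n ≠ 0) : (scaledSymbol k a n).natDegree = k := by
  refine natDegree_eq_of_le_of_coeff_ne_zero ?_ (coeff_scaledSymbol_self_ne_zero hak hkn hn)
  refine natDegree_sum_le_of_forall_le _ _ fun j hj => ?_
  exact (natDegree_C_mul_X_pow_le _ _).trans (Nat.lt_succ_iff.1 (Finset.mem_range.1 hj))

lemma tendsto_descFactorial_div_pow (j : ℕ) :
    Tendsto (fun n : ℕ => (n.descFactorial j : ℂ) / (n : ℂ) ^ j) atTop (𝓝 1) := by
  have h : Tendsto (fun n : ℕ => (n.descFactorial j : ℝ) / (n : ℝ) ^ j) atTop (𝓝 1) := by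
    refine (Asymptotics.isEquivalent_iff_tendsto_one ?_).1 (isEquivalent_descFactorial j)
    filter_upwards [eventually_ne_atTop 0] with n hn
    exact pow_ne_zero _ (by exact_mod_cast hn)
  simpa [Function.comp_def] using (Complex.continuous_ofReal.tendsto 1).comp h

/-- Each zero of `∑ a j tʲ` is a limit of zeros of the rescaled symbols. -/
lemma exists_root_scaledSymbol_near {k : ℕ} {a : ℕ → ℂ} (hak : a k ≠ 0) {l : ℂ}
    (hl : ∑ j ∈ Finset.range (k + 1), a j * l ^ j = 0) {ε : ℝ} (hε : 0 < ε) :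
    ∀ᶠ n in atTop, ∃ r, (scaledSymbol k a n).eval r = 0 ∧ ‖l - r‖ < ε := by
  have h1 : Tendsto (fun n => (scaledSymbol k a n).eval l) atTop (𝓝 0) := by
    rw [← hl]
    simp only [scaledSymbol, eval_finsetSum, eval_mul, eval_C, eval_pow, eval_X]
    refine tendsto_finsetSum _ fun j _ => ?_
    simpa using ((tendsto_descFactorial_div_pow j).const_mul (a j)).mul_const (l ^ j)
  have h2 : Tendsto (fun n => (scaledSymbol k a n).coeff k) atTop (𝓝 (a k)) := by
    simp only [coeff_scaledSymbol_self]
    simpa using (tendsto_descFactorial_div_pow k).const_mul (a k)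
  have h3 := h1.norm.eventually_lt (h2.norm.mul_const (ε ^ k)) (by
    rw [norm_zero]
    exact mul_pos (norm_pos_iff.2 hak) (pow_pos hε k))
  filter_upwards [h3, eventually_ge_atTop k, eventually_ne_atTop 0] with n hn hkn hn0
  apply exists_root_norm_sub_lt hε.le
  rwa [leadingCoeff, natDegree_scaledSymbol hak hkn hn0]

lemma eval_operator_X_sub_C_pow (k : ℕ) (a : ℕ → ℂ) {n : ℕ} (hn : n ≠ 0) (w : ℂ) {t : ℂ}
    (ht : t ≠ 0) :
    (∑ j ∈ Finset.range (k + 1), C (a j) * derivative^[j] ((X - C w) ^ n)).eval (w + n / t) =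
      (n / t) ^ n * (scaledSymbol k a n).eval t := by
  have hn' : (n : ℂ) ≠ 0 := by exact_mod_cast hn
  simp only [scaledSymbol, eval_finsetSum, Finset.mul_sum]
  refine Finset.sum_congr rfl fun j _ => ?_
  rw [iterate_derivative_X_sub_pow]
  simp only [eval_mul, eval_C, eval_pow, eval_X, nsmul_eq_mul, eval_natCast, eval_sub,
    add_sub_cancel_left]
  rcases lt_or_ge n j with h | h
  · simp [Nat.descFactorial_eq_zero_iff_lt.2 h]
  · obtain ⟨m, rfl⟩ := Nat.exists_eq_add_of_le h
    rw [Nat.add_sub_cancel_left, pow_add, div_pow _ _ j]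
    field_simp

/-- An invariant closed convex set contains the ray in direction `l⁻¹` from each of its points, for
every nonzero zero `l` of the symbol. -/
lemma TInvariant.add_mul_inv_mem {k : ℕ} {a : ℕ → ℂ} (hak : a k ≠ 0) {S : Set ℂ}
    (hSclosed : IsClosed S) (hSconv : Convex ℝ S)
    (hT : TInvariant (fun p => ∑ j ∈ Finset.range (k + 1), C (a j) * derivative^[j] p) S) {l : ℂ}
    (hl0 : l ≠ 0) (hl : ∑ j ∈ Finset.range (k + 1), a j * l ^ j = 0) {w : ℂ} (hw : w ∈ S) {s : ℝ}
    (hs : 0 ≤ s) : w + (s : ℂ) * l⁻¹ ∈ S := by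
  have hcont : ContinuousAt (fun t : ℂ => w + (s : ℂ) * t⁻¹) l := by fun_prop (disch := exact hl0)
  rw [← hSclosed.closure_eq, mem_closure_iff_nhds]
  intro U hU
  obtain ⟨ε, hε, hεU⟩ := Metric.eventually_nhds_iff.1
    ((hcont.eventually hU).and (eventually_ne_nhds hl0))
  obtain ⟨N, hN⟩ := exists_nat_ge s
  obtain ⟨n, ⟨t, ht, htl⟩, hkn, hn0, hNn⟩ := ((exists_root_scaledSymbol_near hak hl hε).and
    ((eventually_ge_atTop k).and ((eventually_ne_atTop 0).and (eventually_ge_atTop N)))).exists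
  obtain ⟨htU, ht0⟩ := hεU (show dist t l < ε by rwa [dist_comm, dist_eq_norm])
  refine ⟨_, htU, ?_⟩
  have hn' : (n : ℝ) ≠ 0 := by exact_mod_cast hn0
  have hnC : (n : ℂ) ≠ 0 := by exact_mod_cast hn0
  have hz : w + n / t ∈ S := by
    rcases hT ((X - C w) ^ n) (pow_ne_zero _ (X_sub_C_ne_zero w)) (fun z hz => by
      have : z = w := by simpa [hn0, sub_eq_zero] using hz
      rwa [this]) with h | h
    · exfalso
      have hne : scaledSymbol k a n ≠ 0 := fun h =>
        coeff_scaledSymbol_self_ne_zero hak hkn hn0 (by simp [h])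
      obtain ⟨t', ht'⟩ :=
        Infinite.exists_notMem_finset (insert 0 (scaledSymbol k a n).roots.toFinset)
      simp only [Finset.mem_insert, Multiset.mem_toFinset, mem_roots hne, not_or] at ht'
      have := eval_operator_X_sub_C_pow k a hn0 w ht'.1
      simp only at h
      rw [h, eval_zero] at this
      exact mul_ne_zero (pow_ne_zero n (div_ne_zero hnC ht'.1)) ht'.2 this.symm
    · apply h
      simp only
      rw [eval_operator_X_sub_C_pow k a hn0 w ht0, ht, mul_zero]
  have hsn : s / n ≤ 1 := by
    refine div_le_one_of_le₀ (hN.trans (by exact_mod_cast hNn)) (by positivity)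
  have := hSconv.add_smul_sub_mem hw hz (t := s / n) ⟨by positivity, hsn⟩
  convert this using 2
  rw [add_sub_cancel_left, Complex.real_smul]
  push_cast
  field_simp

theorem constant_coefficient_invariant_iff_closed_wrt_cone (k : ℕ) (hk : 1 ≤ k)
    (a : ℕ → ℂ) (hak : a k ≠ 0)
    (T : Polynomial ℂ → Polynomial ℂ)
    (hT : T = fun p => ∑ j ∈ Finset.range (k + 1),
      Polynomial.C (a j) * (⇑(Polynomial.derivative (R := ℂ)))^[j] p)
    (lam : Fin k → ℂ)
    (hlam : (∑ j ∈ Finset.range (k + 1), Polynomial.C (a j) * Polynomial.X ^ j) =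
      Polynomial.C (a k) * ∏ i : Fin k, (Polynomial.X - Polynomial.C (lam i)))
    (Cone : Set ℂ)
    (hCone : Cone = {v : ℂ | ∃ α : Fin k → ℝ, (∀ i, 0 ≤ α i) ∧
      v = ∑ i : Fin k, (α i : ℂ) * (lam i)⁻¹})
    (S : Set ℂ) (hSclosed : IsClosed S) (hSconv : Convex ℝ S) :
    TInvariant T S ↔ ∀ z ∈ S, ∀ v ∈ Cone, z + v ∈ S := by
  subst hCone
  constructor
  · rintro hinv z hz v ⟨α, hα, rfl⟩
    subst hT
    have hray : ∀ i, ∀ w ∈ S, w + (α i : ℂ) * (lam i)⁻¹ ∈ S := by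
      intro i w hw
      rcases eq_or_ne (lam i) 0 with h0 | h0
      · simpa [h0] using hw
      · refine hinv.add_mul_inv_mem hak hSclosed hSconv h0 ?_ hw (hα i)
        have := congrArg (eval (lam i)) hlam
        have hprod : ∏ j, (lam i - lam j) = 0 :=
          Finset.prod_eq_zero (Finset.mem_univ i) (sub_self _)
        simpa [eval_finsetSum, eval_prod, hprod] using this
    have hpartial : ∀ F : Finset (Fin k), z + ∑ i ∈ F, (α i : ℂ) * (lam i)⁻¹ ∈ S := by
      intro F
      induction F using Finset.induction_on with
      | empty => simpa using hz
      | insert i F hi ih =>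
        rw [Finset.sum_insert hi, add_comm (_ * _), ← add_assoc]
        exact hray i _ ih
    exact hpartial Finset.univ
  · intro hcone p hp0 hp
    have hTp : T p = C (a k) * aeval (derivative (R := ℂ)) (∏ i, (X - C (lam i))) p := by
      have := congrArg (fun q => aeval (derivative (R := ℂ)) q p) hlam
      simpa [hT, Module.End.pow_apply, smul_eq_C_mul, Module.algebraMap_end_apply] using this
    have hfactor : ∀ F : Finset (Fin k),
        aeval (derivative (R := ℂ)) (∏ i ∈ F, (X - C (lam i))) p = 0 ∨
          ∀ z, (aeval (derivative (R := ℂ)) (∏ i ∈ F, (X - C (lam i))) p).eval z = 0 → z ∈ S := by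
      intro F
      induction F using Finset.induction_on with
      | empty => exact Or.inr (by simpa using hp)
      | insert i F hi ih =>
        rw [Finset.prod_insert hi, map_mul, Module.End.mul_apply]
        have hstep := mem_of_eval_derivative_sub_eq_zero hSclosed hSconv (l := lam i)
          (fun z hz t ht => hcone z hz _ ⟨Pi.single i t, fun j => ?_, ?_⟩) ih
        · simpa [Module.algebraMap_end_apply, smul_eq_C_mul] using hstep
        · by_cases h : j = i
          · subst h
            simpa using ht
          · simp [h]
        · rw [Finset.sum_eq_single i (fun j _ hj => by simp [hj]) (by simp)]
          simp
    rw [hTp]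
    refine (hfactor Finset.univ).imp (fun h => by rw [h, mul_zero]) fun h z hz => h z ?_
    rw [eval_mul, eval_C] at hz
    exact (mul_eq_zero.1 hz).resolve_left hak
end

section
/- Let T be the operator T(p)(x) = p′(x) − x·p(x) on ℂ[x]. Then: (a) the real axis ℝ ⊂ ℂ is T_{≥0}-invariant, i.e. for every nonzero polynomial p all of whose complex zeros are real, all complex zeros of p′(x) − x·p(x) are real; and (b) ℝ is a minimal T-invariant set: no nonempty proper closed subset of ℝ is T_{≥0}-invariant. -/
open Polynomial

/-- The imaginary part of the logarithmic derivative of a polynomial with real zeros has the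
sign opposite to that of the imaginary part of the argument. -/
theorem im_mul_im_logDeriv_nonpos {p : ℂ[X]} (hp : p ≠ 0)
    (hreal : ∀ w : ℂ, p.eval w = 0 → w.im = 0) {z : ℂ} (hz : p.eval z ≠ 0) :
    z.im * (p.derivative.eval z / p.eval z).im ≤ 0 := by
  rw [(IsAlgClosed.splits p).eval_derivative_div_eval_of_ne_zero hz]
  have hroots : ∀ w ∈ p.roots, w.im = 0 := fun w hw => hreal w ((mem_roots hp).1 hw)
  generalize p.roots = s at hroots
  induction s using Multiset.induction_on with
  | empty => simp
  | cons a s ih =>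
    have ha : a.im = 0 := hroots a (Multiset.mem_cons_self a s)
    have hs := ih fun w hw => hroots w (Multiset.mem_cons_of_mem hw)
    have h : z.im * (1 / (z - a)).im ≤ 0 := by
      rw [one_div, Complex.inv_im, Complex.sub_im, ha, sub_zero, mul_div_assoc', mul_neg]
      exact div_nonpos_of_nonpos_of_nonneg (neg_nonpos.2 (mul_self_nonneg _))
        (Complex.normSq_nonneg _)
    rw [Multiset.map_cons, Multiset.sum_cons, Complex.add_im, mul_add]
    exact add_nonpos h hs

/-- If all zeros of `p ≠ 0` are real, then so are those of `derivative p - X * p`. -/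
theorem im_eq_zero_of_eval_derivative_sub_X_mul {p : ℂ[X]} (hp : p ≠ 0)
    (hreal : ∀ w : ℂ, p.eval w = 0 → w.im = 0) {z : ℂ}
    (hz : (derivative p - X * p).eval z = 0) : z.im = 0 := by
  by_cases hpz : p.eval z = 0
  · exact hreal z hpz
  have hdiv : p.derivative.eval z / p.eval z = z := by
    rw [div_eq_iff hpz]
    simpa [sub_eq_zero] using hz
  have h := im_mul_im_logDeriv_nonpos hp hreal hpz
  rw [hdiv] at h
  exact mul_self_eq_zero.1 (le_antisymm h (mul_self_nonneg _))

/-- The zeros of `X * (X - a) - m` are zeros of `derivative p - X * p` for `p = (X - a) ^ m`. -/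
theorem eval_derivative_sub_X_mul_X_sub_C_pow {a z : ℂ} {m : ℕ} (hm : m ≠ 0)
    (hz : z * (z - a) = m) :
    (derivative ((X - C a) ^ m) - X * (X - C a) ^ m).eval z = 0 := by
  obtain ⟨n, rfl⟩ := Nat.exists_eq_succ_of_ne_zero hm
  simp only [derivative_X_sub_C_pow, eval_sub, eval_mul, eval_pow, eval_X, eval_C,
    Nat.succ_sub_one, Nat.succ_eq_add_one, ← hz]
  ring

/-- For large `y`, the square roots of positive integers approximate `y` arbitrarily well. -/
theorem exists_sqrt_natCast_near {ε y : ℝ} (hy : 1 ≤ y) (hε : 1 < ε * y) :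
    ∃ k : ℕ, k ≠ 0 ∧ |√(k : ℝ) - y| < ε := by
  have hy2 : 1 ≤ y ^ 2 := one_le_pow₀ hy
  refine ⟨⌊y ^ 2⌋₊, (Nat.floor_pos.2 hy2).ne', ?_⟩
  have hle : (⌊y ^ 2⌋₊ : ℝ) ≤ y ^ 2 := Nat.floor_le (by positivity)
  have hlt : y ^ 2 < ⌊y ^ 2⌋₊ + 1 := Nat.lt_floor_add_one _
  have hsq := Real.sq_sqrt (Nat.cast_nonneg (α := ℝ) ⌊y ^ 2⌋₊)
  have hnn := Real.sqrt_nonneg (⌊y ^ 2⌋₊ : ℝ)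
  have hay : √(⌊y ^ 2⌋₊ : ℝ) ≤ y := Real.sqrt_le_iff.2 ⟨by linarith, hle⟩
  rw [abs_sub_comm, abs_of_nonneg (sub_nonneg.2 hay)]
  have : (y - √(⌊y ^ 2⌋₊ : ℝ)) * y < ε * y := by
    nlinarith [mul_nonneg (sub_nonneg.2 hay) hnn]
  exact lt_of_mul_lt_mul_right this (by linarith)

/-- On negative reals, `t ↦ t - m / t` does not decrease distances. -/
theorem abs_sub_le_of_mul_sub_eq {a y t x m : ℝ} (hm : 0 ≤ m) (ht : t < 0) (hx : x < 0)
    (hta : t * (t - a) = m) (hxy : x * (x - y) = m) : |t - x| ≤ |a - y| := by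
  have hpos : 0 < x * t := mul_pos_of_neg_of_neg hx ht
  have key : (t - x) * (x * t + m) = (a - y) * (x * t) := by
    linear_combination x * hta - t * hxy
  have habs := congrArg abs key
  rw [abs_mul, abs_mul, abs_of_pos hpos, abs_of_pos (by linarith : 0 < x * t + m)] at habs
  refine le_of_mul_le_mul_right ?_ hpos
  nlinarith [mul_nonneg (abs_nonneg (t - x)) hm]

/-- A closed set of reals that contains `0` and the solutions `x` of `x * (x - a) = m`, for each
of its elements `a` and each positive integer `m`, contains all negative reals. -/
theorem mem_of_neg_of_isClosed {A : Set ℝ} (hA : IsClosed A) (h0 : 0 ∈ A)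
    (hstep : ∀ a ∈ A, ∀ (m : ℕ) (x : ℝ), m ≠ 0 → x * (x - a) = m → x ∈ A)
    {x : ℝ} (hx : x < 0) : x ∈ A := by
  rw [← hA.closure_eq, Metric.mem_closure_iff]
  intro ε hε
  obtain ⟨m, hm⟩ := exists_nat_gt ((1 + 1 / ε - x) * (-x))
  have hε' : 0 < 1 / ε := one_div_pos.2 hε
  have hmpos : (0 : ℝ) < m := (mul_pos (by linarith) (by linarith)).trans hm
  obtain ⟨y, hxy⟩ : ∃ y, x * (x - y) = m :=
    ⟨x - m / x, by rw [sub_sub_cancel, mul_div_cancel₀ _ hx.ne]⟩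
  have hy : 1 + 1 / ε < y := by
    refine lt_of_mul_lt_mul_right (a := -x) ?_ (by linarith)
    nlinarith
  have hεy : 1 < ε * y := by
    have := mul_lt_mul_of_pos_left hy hε
    rw [mul_add, mul_one_div_cancel hε.ne'] at this
    linarith
  obtain ⟨k, hk, hky⟩ := exists_sqrt_natCast_near (by linarith) hεy
  set a := √(k : ℝ) with ha
  have haA : a ∈ A := hstep 0 h0 k a hk (by
    rw [sub_zero, ha, Real.mul_self_sqrt (Nat.cast_nonneg k)])
  set d := √(a ^ 2 + 4 * m) with hd
  have hd2 : d ^ 2 = a ^ 2 + 4 * m := Real.sq_sqrt (by positivity)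
  have had : a < d := Real.lt_sqrt_of_sq_lt (by linarith)
  have ht : (a - d) / 2 * ((a - d) / 2 - a) = m := by linear_combination hd2 / 4
  refine ⟨(a - d) / 2, hstep a haA m _ (by exact_mod_cast hmpos.ne') ht, ?_⟩
  rw [dist_comm, Real.dist_eq]
  exact (abs_sub_le_of_mul_sub_eq hmpos.le (by linarith) hx ht hxy).trans_lt hky

theorem real_axis_minimal_invariant_for_d_minus_x
    (T : Polynomial ℂ → Polynomial ℂ)
    (hT : T = fun p => Polynomial.derivative p - Polynomial.X * p) :
    TInvariant T {z : ℂ | z.im = 0} ∧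
      ∀ S : Set ℂ, S ⊆ {z : ℂ | z.im = 0} → S.Nonempty → IsClosed S →
        TInvariant T S → S = {z : ℂ | z.im = 0} := by
  subst hT
  refine ⟨fun p hp hreal => Or.inr fun z hz =>
    im_eq_zero_of_eval_derivative_sub_X_mul hp hreal hz, ?_⟩
  intro S hS _ hclosed hinv
  have h0 : (0 : ℂ) ∈ S := by
    rcases hinv 1 one_ne_zero (by simp) with h | h
    · simp at h
    · exact h 0 (by simp)
  have hstep : ∀ a ∈ S, ∀ (m : ℕ) (z : ℂ), m ≠ 0 → z * (z - a) = m → z ∈ S := by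
    intro a ha m z hm hz
    have hroot := eval_derivative_sub_X_mul_X_sub_C_pow hm hz
    rcases hinv ((X - C a) ^ m) (pow_ne_zero _ (X_sub_C_ne_zero a)) (fun w hw => by
      have : w = a := by simpa [hm, sub_eq_zero] using hw
      exact this ▸ ha) with h | h
    · have hne : (X - C a) ^ m ≠ 0 := pow_ne_zero _ (X_sub_C_ne_zero a)
      have hX := sub_eq_zero.1 h
      have hlt := degree_derivative_lt hne
      rw [hX, degree_mul, degree_X, degree_eq_natDegree hne] at hlt
      norm_cast at hlt
      omega
    · exact h z hroot
  refine hS.antisymm fun z hz => ?_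
  obtain ⟨x, rfl⟩ : ∃ x : ℝ, (x : ℂ) = z := ⟨z.re, Complex.ext rfl (by simpa using hz.symm)⟩
  rcases lt_trichotomy x 0 with hx | rfl | hx
  · refine mem_of_neg_of_isClosed (A := {t : ℝ | (t : ℂ) ∈ S})
      (hclosed.preimage Complex.continuous_ofReal) (by simpa using h0) ?_ hx
    exact fun a ha m t hm ht => hstep a ha m t hm (by exact_mod_cast ht)
  · simpa using h0
  · have h := mem_of_neg_of_isClosed (A := {t : ℝ | ((-t : ℝ) : ℂ) ∈ S})
      (hclosed.preimage (Complex.continuous_ofReal.comp continuous_neg)) (by simpa using h0)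
      (fun a ha m t hm ht => hstep _ ha m _ hm (by
        have : -t * (-t - -a) = m := by linarith
        exact_mod_cast this)) (neg_lt_zero.2 hx)
    simpa using h
end
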